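/- Monotonicity and convexity of the containing-case optimal values (the Claim proved inside Lemma 8 of the paper): with j₀ := max(m, ⌈β/(2z)⌉), the sequence OptC(j) is nonincreasing and convex on [j₀, n]; that is, OptC(j) ≤ OptC(j−1) for every j with j₀ < j ≤ n, and OptC(j+1) − OptC(j) ≥ OptC(j) − OptC(j−1) for every j with j₀ < j < n. -/

import Mathlib

/-- A configuration `y` of the `n` sensors (with covering range `z`) covers the
barrier `[0, β]`. -/
def Covers (n : ℕ) (z β : ℝ) (y : ℕ → ℝ) : Prop :=
  Set.Icc (0 : ℝ) β ⊆ ⋃ i ∈ Finset.Icc 1 n, Set.Icc (y i - z) (y i + z)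

/-- The cost of moving the sensors from positions `x` to positions `y`. -/
noncomputable def Cost (n : ℕ) (x y : ℕ → ℝ) : ℝ :=
  ∑ i ∈ Finset.Icc 1 n, |x i - y i|

/-- The optimal (infimum) cost over all covering configurations. -/
noncomputable def OptCost (n : ℕ) (z β : ℝ) (x : ℕ → ℝ) : ℝ :=
  sInf {c : ℝ | ∃ y : ℕ → ℝ, Covers n z β y ∧ c = Cost n x y}

/-- One-sided case: the optimal cost `OptC(j)` of the containing-case instance on the
first `j` sensors, where sensors `m+1, …, j` have been moved to `β + z`. -/
noncomputable def OptC (m : ℕ) (z β : ℝ) (x : ℕ → ℝ) (j : ℕ) : ℝ :=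
  sInf {c : ℝ | ∃ y : ℕ → ℝ, Covers j z β y ∧
    c = ∑ i ∈ Finset.Icc 1 j, |(if i ≤ m then x i else β + z) - y i|}

/-- `D(j)`: the cost of moving sensors `m+1, …, j` leftwards to `β + z` plus the
optimal cost of the resulting containing-case instance on the first `j` sensors. -/
noncomputable def DVal (m : ℕ) (z β : ℝ) (x : ℕ → ℝ) (j : ℕ) : ℝ :=
  (∑ i ∈ Finset.Icc (m + 1) j, (x i - z - β)) + OptC m z β x j

/-- Consecutive sensors leave no gap, and the first and last ones reach the ends of `[0, β]`. -/
def IsCoverChain (j : ℕ) (z β : ℝ) (v : ℕ → ℝ) : Prop :=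
  v 1 ≤ z ∧ (∀ i, 1 ≤ i → i < j → v (i + 1) ≤ v i + 2 * z) ∧ β - z ≤ v j

theorem covers_iff {n : ℕ} {z β : ℝ} {y : ℕ → ℝ} :
    Covers n z β y ↔ ∀ t, 0 ≤ t → t ≤ β → ∃ i, 1 ≤ i ∧ i ≤ n ∧ y i - z ≤ t ∧ t ≤ y i + z := by
  simp only [Covers, Set.subset_def, Set.mem_iUnion, Set.mem_Icc, Finset.mem_Icc]
  constructor
  · intro h t h0 h1
    obtain ⟨i, ⟨hi, hi'⟩, h⟩ := h t ⟨h0, h1⟩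
    exact ⟨i, hi, hi', h⟩
  · rintro h t ⟨h0, h1⟩
    obtain ⟨i, hi, hi', h⟩ := h t h0 h1
    exact ⟨i, ⟨hi, hi'⟩, h⟩

theorem IsCoverChain.covers {j : ℕ} {z β : ℝ} {v : ℕ → ℝ} (hj : 1 ≤ j) (h : IsCoverChain j z β v) :
    Covers j z β v := by
  classical
  obtain ⟨hfirst, hstep, hlast⟩ := h
  rw [covers_iff]
  intro t h0 h1
  have hex : ∃ i, 1 ≤ i ∧ t ≤ v i + z := ⟨j, hj, by linarith⟩
  obtain ⟨hi1, hit⟩ := Nat.find_spec hex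
  have hij : Nat.find hex ≤ j := Nat.find_min' hex ⟨hj, by linarith⟩
  have hmin : ∀ i, i < Nat.find hex → ¬(1 ≤ i ∧ t ≤ v i + z) := fun i => Nat.find_min hex
  generalize Nat.find hex = i at *
  refine ⟨i, hi1, hij, ?_, hit⟩
  rcases Nat.lt_or_ge 1 i with hi | hi
  · obtain ⟨k, rfl⟩ : ∃ k, i = k + 1 := ⟨i - 1, by omega⟩
    have hk := hmin k (by omega)
    have hk' : v k + z < t := by
      by_contra hc
      exact hk ⟨by omega, not_lt.mp hc⟩
    have := hstep k (by omega) (by omega)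
    linarith
  · obtain rfl : i = 1 := by omega
    linarith

theorem IsCoverChain.le_add {j m : ℕ} {z β : ℝ} {v : ℕ → ℝ} (h : IsCoverChain j z β v) (hm : 1 ≤ m)
    (l : ℕ) (hl : m + l ≤ j) : v (m + l) ≤ v m + 2 * z * l := by
  induction l with
  | zero => simp
  | succ l ih =>
    have h1 := ih (by omega)
    have h2 := h.2.1 (m + l) (by omega) (by omega)
    rw [← add_assoc]
    push_cast
    linarith

theorem abs_sub_add_abs_sub_swap_le {a b c d : ℝ} (hab : a ≤ b) (hcd : c ≤ d) :
    |a - c| + |b - d| ≤ |a - d| + |b - c| := by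
  rcases abs_cases (a - c) with h1 | h1 <;> rcases abs_cases (b - d) with h2 | h2 <;>
    rcases abs_cases (a - d) with h3 | h3 <;> rcases abs_cases (b - c) with h4 | h4 <;> linarith

/-- Sorting the targets of sorted sources does not increase the total distance. -/
theorem sum_abs_sub_sort_le {n : ℕ} (p f : Fin n → ℝ) (hp : Monotone p) :
    ∑ i, |p i - (f ∘ Tuple.sort f) i| ≤ ∑ i, |p i - f i| := by
  refine Tuple.bubble_sort_induction
    (P := fun g : Fin n → ℝ => ∑ i, |p i - g i| ≤ ∑ i, |p i - f i|) le_rfl ?_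
  intro g a b hab hlt hg
  refine le_trans ?_ hg
  have hne : b ∈ Finset.univ.erase a := by simp [hab.ne']
  rw [← Finset.add_sum_erase _ _ (Finset.mem_univ a), ← Finset.add_sum_erase _ _ hne,
    ← Finset.add_sum_erase _ (fun i => |p i - g i|) (Finset.mem_univ a),
    ← Finset.add_sum_erase _ (fun i => |p i - g i|) hne]
  have hrest : ∑ i ∈ (Finset.univ.erase a).erase b, |p i - (g ∘ Equiv.swap a b) i| =
      ∑ i ∈ (Finset.univ.erase a).erase b, |p i - g i| := by
    refine Finset.sum_congr rfl fun i hi => ?_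
    simp only [Finset.mem_erase, Finset.mem_univ, and_true] at hi
    rw [Function.comp_apply, Equiv.swap_apply_of_ne_of_ne hi.2 hi.1]
  rw [hrest]
  simp only [Function.comp_apply, Equiv.swap_apply_left, Equiv.swap_apply_right]
  have := abs_sub_add_abs_sub_swap_le (hp hab.le) hlt.le
  linarith

theorem sum_Icc_one_eq_sum_fin (j : ℕ) (f : ℕ → ℝ) :
    ∑ i ∈ Finset.Icc 1 j, f i = ∑ i : Fin j, f (i + 1) := by
  rw [Fin.sum_univ_eq_sum_range (fun i => f (i + 1))]
  induction j with
  | zero => simp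
  | succ j ih => rw [Finset.sum_Icc_succ_top (by omega), Finset.sum_range_succ, ih]

theorem sum_Icc_one_add (m k : ℕ) (f : ℕ → ℝ) :
    ∑ i ∈ Finset.Icc 1 (m + k), f i =
      ∑ i ∈ Finset.Icc 1 m, f i + ∑ l ∈ Finset.range k, f (m + (l + 1)) := by
  induction k with
  | zero => simp
  | succ k ih =>
    rw [← add_assoc, Finset.sum_Icc_succ_top (by omega), Finset.sum_range_succ, ih]
    ring_nf

/-- A covering configuration whose sensors all meet `[0, β]` can be sorted into a chain
without increasing the cost. -/
theorem exists_isCoverChain_of_covers_of_mem {j : ℕ} {z β : ℝ} {p u : ℕ → ℝ} (hβ : 0 < β)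
    (hp : ∀ a b, 1 ≤ a → a ≤ b → b ≤ j → p a ≤ p b) (hu : Covers j z β u)
    (hmem : ∀ i, -z ≤ u i ∧ u i ≤ β + z) :
    ∃ v, IsCoverChain j z β v ∧
      ∑ i ∈ Finset.Icc 1 j, |p i - v i| ≤ ∑ i ∈ Finset.Icc 1 j, |p i - u i| := by
  rw [covers_iff] at hu
  let f : Fin j → ℝ := fun i => u (i + 1)
  let g : Fin j → ℝ := f ∘ Tuple.sort f
  have hg : Monotone g := Tuple.monotone_sort f
  have hgmem : ∀ i, -z ≤ g i ∧ g i ≤ β + z := fun i => hmem _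
  have hgcov : ∀ t, 0 ≤ t → t ≤ β → ∃ i, g i - z ≤ t ∧ t ≤ g i + z := by
    intro t h0 h1
    obtain ⟨i, hi1, hij, hi⟩ := hu t h0 h1
    refine ⟨(Tuple.sort f).symm ⟨i - 1, by omega⟩, ?_⟩
    simpa [g, f, Nat.sub_add_cancel hi1] using hi
  obtain ⟨i₀, hi₀, -⟩ := hgcov 0 le_rfl hβ.le
  have hj : 0 < j := i₀.pos
  let v : ℕ → ℝ := fun i => if h : i - 1 < j then g ⟨i - 1, h⟩ else 0
  have hv : ∀ i : Fin j, v (i + 1) = g i := fun i => by simp [v]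
  refine ⟨v, ⟨?_, ?_, ?_⟩, ?_⟩
  · have h1 : v 1 = g ⟨0, hj⟩ := hv ⟨0, hj⟩
    have h2 : g ⟨0, hj⟩ ≤ g i₀ := hg (Fin.mk_le_of_le_val (Nat.zero_le _))
    linarith
  · intro i hi hij
    obtain ⟨k, rfl⟩ : ∃ k, i = k + 1 := ⟨i - 1, by omega⟩
    rw [hv ⟨k, by omega⟩, hv ⟨k + 1, hij⟩]
    by_contra hc
    push Not at hc
    have h1 := (hgmem ⟨k, by omega⟩).1
    have h2 := (hgmem ⟨k + 1, hij⟩).2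
    obtain ⟨l, hl1, hl2⟩ := hgcov ((g ⟨k, by omega⟩ + g ⟨k + 1, hij⟩) / 2)
      (by linarith) (by linarith)
    rcases Nat.lt_or_ge k l with h | h
    · have : g ⟨k + 1, hij⟩ ≤ g l := hg (Fin.mk_le_of_le_val h)
      linarith
    · have : g l ≤ g ⟨k, by omega⟩ := hg (Fin.le_def.mpr h)
      linarith
  · obtain ⟨l, -, hl⟩ := hgcov β hβ.le le_rfl
    have h1 : v j = g ⟨j - 1, by omega⟩ := by
      rw [← hv]
      congr 1
      simp only
      omega
    have h2 : g l ≤ g ⟨j - 1, by omega⟩ := hg (Fin.le_def.mpr (by simp only; omega))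
    linarith
  · rw [sum_Icc_one_eq_sum_fin, sum_Icc_one_eq_sum_fin]
    simp only [hv]
    refine sum_abs_sub_sort_le (fun i : Fin j => p (i + 1)) f fun a b hab => ?_
    exact hp _ _ (by omega) (by have := Fin.le_def.mp hab; omega) (by omega)

theorem exists_isCoverChain_of_covers {j : ℕ} {z β : ℝ} {p y : ℕ → ℝ} (hz : 0 < z) (hβ : 0 < β)
    (hp : ∀ a b, 1 ≤ a → a ≤ b → b ≤ j → p a ≤ p b)
    (hpmem : ∀ i, 1 ≤ i → i ≤ j → -z ≤ p i ∧ p i ≤ β + z) (hy : Covers j z β y) :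
    ∃ v, IsCoverChain j z β v ∧
      ∑ i ∈ Finset.Icc 1 j, |p i - v i| ≤ ∑ i ∈ Finset.Icc 1 j, |p i - y i| := by
  let u : ℕ → ℝ := fun i => max (-z) (min (β + z) (y i))
  have hu : Covers j z β u := by
    rw [covers_iff] at hy ⊢
    intro t h0 h1
    obtain ⟨i, hi1, hij, hl, hr⟩ := hy t h0 h1
    refine ⟨i, hi1, hij, ?_, ?_⟩
    · have : u i ≤ t + z :=
        max_le (by linarith) ((min_le_right _ _).trans (by linarith))
      linarith
    · have : t - z ≤ u i := le_max_of_le_right (le_min (by linarith) (by linarith))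
      linarith
  obtain ⟨v, hv, hcost⟩ := exists_isCoverChain_of_covers_of_mem hβ hp hu
    fun i => ⟨le_max_left _ _, max_le (by linarith) (min_le_left _ _)⟩
  refine ⟨v, hv, hcost.trans (Finset.sum_le_sum fun i hi => ?_)⟩
  obtain ⟨hi1, hij⟩ := Finset.mem_Icc.mp hi
  obtain ⟨hl, hr⟩ := hpmem i hi1 hij
  have hcl : max (-z) (min (β + z) (p i)) = p i := by
    rw [min_eq_right hr, max_eq_right hl]
  calc |p i - u i| = |max (min (β + z) (p i)) (-z) - max (min (β + z) (y i)) (-z)| := by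
        rw [max_comm _ (-z), max_comm _ (-z), hcl]
    _ ≤ |min (β + z) (p i) - min (β + z) (y i)| := abs_max_sub_max_le_abs _ _ _
    _ ≤ |p i - y i| := by
        simpa using abs_min_sub_min_le_max (β + z) (p i) (β + z) (y i)

theorem bddBelow_setOf_cost (m : ℕ) (z β : ℝ) (x : ℕ → ℝ) (j : ℕ) :
    BddBelow {c : ℝ | ∃ y : ℕ → ℝ, Covers j z β y ∧
      c = ∑ i ∈ Finset.Icc 1 j, |(if i ≤ m then x i else β + z) - y i|} := by
  refine ⟨0, ?_⟩
  rintro c ⟨y, -, rfl⟩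
  exact Finset.sum_nonneg fun i _ => abs_nonneg _

theorem OptC_le_of_covers {m j : ℕ} {z β : ℝ} {x y : ℕ → ℝ} (hy : Covers j z β y) :
    OptC m z β x j ≤ ∑ i ∈ Finset.Icc 1 j, |(if i ≤ m then x i else β + z) - y i| :=
  csInf_le (bddBelow_setOf_cost m z β x j) ⟨y, hy, rfl⟩

theorem exists_covers {j : ℕ} {z β : ℝ} (hj : 1 ≤ j) (h : β ≤ 2 * z * j) :
    ∃ y, Covers j z β y := by
  refine ⟨fun i => 2 * z * i - z, IsCoverChain.covers hj ⟨?_, ?_, ?_⟩⟩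
  · norm_num
    linarith
  · intro i _ _
    push_cast
    linarith
  · linarith

theorem le_OptC {m j : ℕ} {z β : ℝ} {x : ℕ → ℝ} {b : ℝ} (hj : 1 ≤ j) (hfeas : β ≤ 2 * z * j)
    (h : ∀ y, Covers j z β y →
      b ≤ ∑ i ∈ Finset.Icc 1 j, |(if i ≤ m then x i else β + z) - y i|) :
    b ≤ OptC m z β x j := by
  obtain ⟨y, hy⟩ := exists_covers hj hfeas
  refine le_csInf ⟨_, y, hy, rfl⟩ ?_
  rintro c ⟨y, hy, rfl⟩
  exact h y hy

theorem OptC_succ_le {m j : ℕ} {z β : ℝ} {x : ℕ → ℝ} (hm : 1 ≤ m) (hmj : m ≤ j)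
    (hfeas : β ≤ 2 * z * j) : OptC m z β x (j + 1) ≤ OptC m z β x j := by
  refine le_OptC (by omega) hfeas fun y hy => ?_
  have hcov : Covers (j + 1) z β (Function.update y (j + 1) (β + z)) := by
    rw [covers_iff] at hy ⊢
    intro t h0 h1
    obtain ⟨i, hi1, hij, hi⟩ := hy t h0 h1
    refine ⟨i, hi1, by omega, ?_⟩
    rwa [Function.update_of_ne (by omega)]
  refine (OptC_le_of_covers hcov).trans (le_of_eq ?_)
  rw [Finset.sum_Icc_succ_top (by omega), Function.update_self,
    if_neg (by omega : ¬j + 1 ≤ m), sub_self, abs_zero, add_zero]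
  refine Finset.sum_congr rfl fun i hi => ?_
  rw [Function.update_of_ne (by have := Finset.mem_Icc.mp hi; omega)]

theorem sum_modified_cost (m k : ℕ) (z β : ℝ) (x v : ℕ → ℝ) :
    ∑ i ∈ Finset.Icc 1 (m + k), |(if i ≤ m then x i else β + z) - v i| =
      ∑ i ∈ Finset.Icc 1 m, |x i - v i| +
        ∑ l ∈ Finset.range k, |β + z - v (m + (l + 1))| := by
  rw [sum_Icc_one_add]
  congr 1
  · exact Finset.sum_congr rfl fun i hi => by rw [if_pos (Finset.mem_Icc.mp hi).2]
  · exact Finset.sum_congr rfl fun l _ => by rw [if_neg (by omega)]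

/-- The cost of a chain is at least that of its first `m` sensors plus the least cost of
extending them by sensors starting at `β + z`. -/
theorem IsCoverChain.le_cost {m k : ℕ} {z β : ℝ} {x v : ℕ → ℝ} (hm : 1 ≤ m)
    (h : IsCoverChain (m + k) z β v) :
    ∑ i ∈ Finset.Icc 1 m, |x i - v i| +
        ∑ l ∈ Finset.range k, max 0 (β + z - v m - 2 * z * (l + 1)) ≤
      ∑ i ∈ Finset.Icc 1 (m + k), |(if i ≤ m then x i else β + z) - v i| := by
  rw [sum_modified_cost]
  gcongr with l hl
  refine max_le (abs_nonneg _) (le_trans ?_ (le_abs_self _))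
  have h1 := h.le_add hm (l + 1) (by have := Finset.mem_range.mp hl; omega)
  push_cast at h1
  linarith

theorem OptC_le_of_prefix {m k : ℕ} {z β : ℝ} {x w : ℕ → ℝ} (hm : 1 ≤ m) (hz : 0 < z)
    (hfirst : w 1 ≤ z) (hstep : ∀ i, 1 ≤ i → i < m → w (i + 1) ≤ w i + 2 * z)
    (hlast : β - z ≤ w m + 2 * z * k) :
    OptC m z β x (m + k) ≤ ∑ i ∈ Finset.Icc 1 m, |x i - w i| +
      ∑ l ∈ Finset.range k, max 0 (β + z - w m - 2 * z * (l + 1)) := by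
  let v : ℕ → ℝ := fun i => if i ≤ m then w i else min (β + z) (w m + 2 * z * (i - m))
  have hvle : ∀ i, i ≤ m → v i = w i := fun i hi => if_pos hi
  have hvadd : ∀ l : ℕ, v (m + (l + 1)) = min (β + z) (w m + 2 * z * (l + 1)) := by
    intro l
    simp only [v]
    rw [if_neg (by omega)]
    push_cast
    ring_nf
  have hv : IsCoverChain (m + k) z β v := by
    refine ⟨by rwa [hvle 1 hm], ?_, ?_⟩
    · intro i hi _
      rcases lt_trichotomy i m with h | rfl | h
      · rw [hvle i h.le, hvle (i + 1) h]
        exact hstep i hi h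
      · rw [hvle i le_rfl]
        refine (hvadd 0).le.trans ((min_le_right _ _).trans ?_)
        norm_num
      · obtain ⟨l, rfl⟩ : ∃ l, i = m + (l + 1) := ⟨i - m - 1, by omega⟩
        rw [hvadd l, add_assoc, hvadd (l + 1), ← min_add_add_right]
        push_cast
        exact min_le_min (by linarith) (by linarith)
    · cases k with
      | zero =>
        rw [Nat.add_zero, hvle m le_rfl]
        simpa using hlast
      | succ k =>
        rw [hvadd k]
        push_cast at hlast
        exact le_min (by linarith) hlast
  refine (OptC_le_of_covers (hv.covers (by omega))).trans (le_of_eq ?_)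
  rw [sum_modified_cost]
  congr 1
  · exact Finset.sum_congr rfl fun i hi => by rw [hvle i (Finset.mem_Icc.mp hi).2]
  · refine Finset.sum_congr rfl fun l _ => ?_
    rw [hvadd, abs_of_nonneg (sub_nonneg.mpr (min_le_left _ _)), ← max_sub_sub_left]
    congr 1 <;> ring

theorem two_mul_OptC_le_of_isCoverChain {m k : ℕ} {z β : ℝ} {x v v' : ℕ → ℝ} (hm : 1 ≤ m) (hz : 0 < z)
    (hv : IsCoverChain (m + k) z β v) (hv' : IsCoverChain (m + (k + 2)) z β v') :
    2 * OptC m z β x (m + (k + 1)) ≤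
      ∑ i ∈ Finset.Icc 1 (m + k), |(if i ≤ m then x i else β + z) - v i| +
      ∑ i ∈ Finset.Icc 1 (m + (k + 2)), |(if i ≤ m then x i else β + z) - v' i| := by
  have hlast : β - z ≤ v m + 2 * z * k := hv.2.2.trans (hv.le_add hm k le_rfl)
  have hlast' : β - z ≤ v' m + 2 * z * (k + 2) := by
    have := hv'.2.2.trans (hv'.le_add hm (k + 2) le_rfl)
    push_cast at this
    exact this
  have hw : OptC m z β x (m + (k + 1)) ≤
      ∑ i ∈ Finset.Icc 1 m, |x i - (v i + v' i) / 2| +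
      ∑ l ∈ Finset.range (k + 1), max 0 (β + z - (v m + v' m) / 2 - 2 * z * (l + 1)) := by
    refine OptC_le_of_prefix (w := fun i => (v i + v' i) / 2) hm hz ?_ ?_ ?_
    · linarith [hv.1, hv'.1]
    · intro i hi him
      linarith [hv.2.1 i hi (by omega), hv'.2.1 i hi (by omega)]
    · push_cast
      linarith
  have hhead : 2 * ∑ i ∈ Finset.Icc 1 m, |x i - (v i + v' i) / 2| ≤
      ∑ i ∈ Finset.Icc 1 m, |x i - v i| + ∑ i ∈ Finset.Icc 1 m, |x i - v' i| := by
    rw [Finset.mul_sum, ← Finset.sum_add_distrib]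
    refine Finset.sum_le_sum fun i _ => ?_
    calc 2 * |x i - (v i + v' i) / 2| = |(x i - v i) + (x i - v' i)| := by
          rw [← abs_two, ← abs_mul, abs_two]
          ring_nf
      _ ≤ _ := abs_add_le _ _
  have htail : 2 * ∑ l ∈ Finset.range (k + 1),
        max 0 (β + z - (v m + v' m) / 2 - 2 * z * (l + 1)) ≤
      ∑ l ∈ Finset.range (k + 1), max 0 (β + z - v m - 2 * z * (l + 1)) +
        ∑ l ∈ Finset.range (k + 1), max 0 (β + z - v' m - 2 * z * (l + 1)) := by
    rw [Finset.mul_sum, ← Finset.sum_add_distrib]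
    refine Finset.sum_le_sum fun l _ => ?_
    rw [mul_max_of_nonneg _ _ zero_le_two]
    refine max_le ?_ ?_
    · rw [mul_zero]
      positivity
    · have h1 := le_max_right 0 (β + z - v m - 2 * z * (l + 1))
      have h2 := le_max_right 0 (β + z - v' m - 2 * z * (l + 1))
      linarith
  have hext : ∑ l ∈ Finset.range (k + 1), max 0 (β + z - v m - 2 * z * (l + 1)) =
      ∑ l ∈ Finset.range k, max 0 (β + z - v m - 2 * z * (l + 1)) := by
    rw [Finset.sum_range_succ, max_eq_left (by linarith), add_zero]
  have hext' : ∑ l ∈ Finset.range (k + 1), max 0 (β + z - v' m - 2 * z * (l + 1)) ≤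
      ∑ l ∈ Finset.range (k + 2), max 0 (β + z - v' m - 2 * z * (l + 1)) := by
    rw [Finset.sum_range_succ _ (k + 1)]
    exact le_add_of_nonneg_right (le_max_left _ _)
  have hcost := hv.le_cost (x := x) hm
  have hcost' := hv'.le_cost (x := x) hm
  linarith

theorem two_mul_OptC_le {m k : ℕ} {z β : ℝ} {x : ℕ → ℝ} (hm : 1 ≤ m) (hz : 0 < z) (hβ : 0 < β)
    (hmono : ∀ a b, 1 ≤ a → a ≤ b → b ≤ m → x a ≤ x b) (hx1 : -z ≤ x 1) (hxm : x m ≤ β + z)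
    (hfeas : β ≤ 2 * z * (m + k : ℕ)) :
    2 * OptC m z β x (m + (k + 1)) ≤ OptC m z β x (m + k) + OptC m z β x (m + (k + 2)) := by
  let p : ℕ → ℝ := fun i => if i ≤ m then x i else β + z
  have hpmem : ∀ i, 1 ≤ i → -z ≤ p i ∧ p i ≤ β + z := by
    intro i hi
    by_cases him : i ≤ m
    · simp only [p, if_pos him]
      exact ⟨hx1.trans (hmono 1 i le_rfl hi him), (hmono i m hi him le_rfl).trans hxm⟩
    · simp only [p, if_neg him]
      exact ⟨by linarith, le_rfl⟩
  have hp : ∀ a b, 1 ≤ a → a ≤ b → p a ≤ p b := by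
    intro a b ha hab
    by_cases hb : b ≤ m
    · simp only [p, if_pos hb, if_pos (hab.trans hb)]
      exact hmono a b ha hab hb
    · simpa only [p, if_neg hb] using (hpmem a ha).2
  have hfeas' : β ≤ 2 * z * (m + (k + 2) : ℕ) := by
    push_cast at hfeas ⊢
    linarith
  have key : 2 * OptC m z β x (m + (k + 1)) - OptC m z β x (m + (k + 2)) ≤
      OptC m z β x (m + k) := by
    refine le_OptC (by omega) hfeas fun y hy => ?_
    rw [sub_le_comm]
    refine le_OptC (by omega) hfeas' fun y' hy' => ?_
    obtain ⟨v, hv, hc⟩ := exists_isCoverChain_of_covers hz hβ (fun a b ha hab _ => hp a b ha hab)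
      (fun i hi _ => hpmem i hi) hy
    obtain ⟨v', hv', hc'⟩ := exists_isCoverChain_of_covers hz hβ (fun a b ha hab _ => hp a b ha hab)
      (fun i hi _ => hpmem i hi) hy'
    have := two_mul_OptC_le_of_isCoverChain (x := x) hm hz hv hv'
    simp only [p] at hc hc'
    linarith
  linarith

/-- The Claim inside Lemma 8: with `j₀ = max(m, ⌈β/(2z)⌉)`, the containing-case optimal
values `OptC(j)` are nonincreasing and convex on `[j₀, n]`. -/
theorem one_sided_OptC_monotone_convex
    (n : ℕ) (z β : ℝ) (x : ℕ → ℝ) (m j0 : ℕ)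
    (hn : 1 ≤ n) (hz : 0 < z) (hβ : 0 < β)
    (hsort : ∀ i, 1 ≤ i → i < n → x i ≤ x (i + 1))
    (hx1l : -z ≤ x 1) (hx1r : x 1 - z ≤ β) (hfeas : β ≤ 2 * z * n)
    (hm1 : 1 ≤ m) (hmn : m < n)
    (hmle : x m - z ≤ β)
    (hmmax : ∀ i, m < i → i ≤ n → β < x i - z)
    (hj0 : j0 = max m ⌈β / (2 * z)⌉₊) :
    (∀ j, j0 < j → j ≤ n → OptC m z β x j ≤ OptC m z β x (j - 1)) ∧
    (∀ j, j0 < j → j < n →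
      OptC m z β x j - OptC m z β x (j - 1) ≤
        OptC m z β x (j + 1) - OptC m z β x j) := by
  have hceil : ∀ j, j0 ≤ j → β ≤ 2 * z * j := by
    intro j hj
    have h1 : ⌈β / (2 * z)⌉₊ ≤ j := (le_max_right _ _).trans (hj0 ▸ hj)
    have h2 := (div_le_iff₀ (by positivity)).mp (Nat.ceil_le.mp h1)
    linarith
  have hm0 : m ≤ j0 := hj0 ▸ le_max_left _ _
  have hmono : ∀ a b, 1 ≤ a → a ≤ b → b ≤ m → x a ≤ x b := by
    intro a b ha hab
    induction b, hab using Nat.le_induction with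
    | base => exact fun _ => le_rfl
    | succ b hab ih => exact fun hb => (ih (by omega)).trans (hsort b (by omega) (by omega))
  constructor
  · intro j hj _
    obtain ⟨i, rfl⟩ : ∃ i, j = i + 1 := ⟨j - 1, by omega⟩
    exact OptC_succ_le hm1 (by omega) (hceil i (by omega))
  · intro j hj _
    obtain ⟨k, rfl⟩ : ∃ k, j = m + (k + 1) := ⟨j - m - 1, by omega⟩
    have := two_mul_OptC_le hm1 hz hβ hmono hx1l (by linarith) (hceil (m + k) (by omega))
    rw [show m + (k + 1) - 1 = m + k by omega, show m + (k + 1) + 1 = m + (k + 2) by omega]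
    linarith
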